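/- For every n ≥ 1 the number 2·d_n³·v_n is an integer, where (v_n) is the second Apéry sequence. More precisely, for all integers 1 ≤ m ≤ k ≤ n, the rational number d_n³ / (m³·C(n,m)·C(k,m)) is an integer. -/

import Mathlib

/-- The second Apéry sequence
`v_n = ∑_{k=0}^n C(n,k)² C(n+k,k)² (∑_{m=1}^n 1/m³ + ∑_{m=1}^k (-1)^{m-1}/(2m³ C(n,m) C(n+m,m)))`. -/
def aperyV (n : ℕ) : ℚ :=
  ∑ k ∈ Finset.range (n + 1), (n.choose k : ℚ) ^ 2 * ((n + k).choose k : ℚ) ^ 2 *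
    ((∑ m ∈ Finset.Icc 1 n, 1 / (m : ℚ) ^ 3) +
      ∑ m ∈ Finset.Icc 1 k,
        (-1 : ℚ) ^ (m - 1) / (2 * (m : ℚ) ^ 3 * (n.choose m : ℚ) * ((n + m).choose m : ℚ)))

/-- `d_n`: the least common multiple of `1, 2, …, n`. -/
def dlcm (n : ℕ) : ℕ := (Finset.Icc 1 n).lcm id

theorem dvd_dlcm {i n : ℕ} (h1 : 1 ≤ i) (hi : i ≤ n) : i ∣ dlcm n :=
  Finset.dvd_lcm (f := id) (Finset.mem_Icc.2 ⟨h1, hi⟩)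

/-- The recurrence of Leibniz's harmonic triangle, whose entries are `1 / (m C(n,m))`. -/
theorem leibniz_triangle_succ {m n : ℕ} (hm : 1 ≤ m) (hmn : m ≤ n) :
    1 / (((m + 1 : ℕ) : ℚ) * ((n + 1).choose (m + 1) : ℚ)) =
      1 / ((m : ℚ) * (n.choose m : ℚ)) - 1 / ((m : ℚ) * ((n + 1).choose m : ℚ)) := by
  have hm0 : (m : ℚ) ≠ 0 := by exact_mod_cast (by omega : m ≠ 0)
  have hc : (n.choose m : ℚ) ≠ 0 := by exact_mod_cast (Nat.choose_pos hmn).ne'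
  have hc' : ((n + 1).choose m : ℚ) ≠ 0 := by
    exact_mod_cast (Nat.choose_pos (by omega : m ≤ n + 1)).ne'
  have hn1 : (n : ℚ) + 1 ≠ 0 := by positivity
  have hrow : ((m + 1 : ℕ) : ℚ) * ((n + 1).choose (m + 1) : ℚ) = (n + 1) * (n.choose m : ℚ) := by
    have h := Nat.add_one_mul_choose_eq n m
    rw [mul_comm]
    exact_mod_cast h.symm
  have hcol : ((n + 1).choose m : ℚ) * ((n : ℚ) + 1 - m) = (n.choose m : ℚ) * (n + 1) := by
    have h := Nat.choose_mul_succ_eq n m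
    have h' : ((n.choose m * (n + 1) : ℕ) : ℚ) = ((n + 1).choose m * (n + 1 - m) : ℕ) := by rw [h]
    rw [Nat.cast_mul, Nat.cast_mul, Nat.cast_sub (by omega)] at h'
    push_cast at h'
    exact h'.symm
  rw [hrow]
  field_simp
  linear_combination -hcol

/-- If `D / i` is an integer for all `1 ≤ i ≤ N`, then so is `D / (m C(n,m))` for `1 ≤ m ≤ n ≤ N`. -/
theorem div_mul_choose_mem_range {D : ℚ} {N : ℕ}
    (hD : ∀ i, 1 ≤ i → i ≤ N → D * (1 / (i : ℚ)) ∈ (Int.castRingHom ℚ).range)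
    {m : ℕ} (hm : 1 ≤ m) :
    ∀ n, m ≤ n → n ≤ N → D * (1 / ((m : ℚ) * (n.choose m : ℚ))) ∈ (Int.castRingHom ℚ).range := by
  induction m, hm using Nat.le_induction with
  | base =>
    intro n hn hN
    simpa using hD n hn hN
  | succ m hm ih =>
    intro n hn hN
    obtain ⟨n, rfl⟩ : ∃ j, n = j + 1 := ⟨n - 1, by omega⟩
    rw [leibniz_triangle_succ hm (by omega), mul_sub]
    exact sub_mem (ih n (by omega) (by omega)) (ih (n + 1) (by omega) hN)

theorem dlcm_mul_inv_mem_range {i n : ℕ} (h1 : 1 ≤ i) (hi : i ≤ n) :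
    (dlcm n : ℚ) * (1 / (i : ℚ)) ∈ (Int.castRingHom ℚ).range := by
  obtain ⟨c, hc⟩ := dvd_dlcm h1 hi
  have hi0 : (i : ℚ) ≠ 0 := by exact_mod_cast (by omega : i ≠ 0)
  refine ⟨c, ?_⟩
  rw [hc]
  simp
  field_simp

theorem dlcm_cube_div_mem_range {n m k : ℕ} (hm : 1 ≤ m) (hmk : m ≤ k) (hkn : k ≤ n) :
    (dlcm n : ℚ) ^ 3 / ((m : ℚ) ^ 3 * (n.choose m : ℚ) * (k.choose m : ℚ)) ∈
      (Int.castRingHom ℚ).range := by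
  have h := div_mul_choose_mem_range (D := (dlcm n : ℚ)) (N := n)
    (fun i h1 hi => dlcm_mul_inv_mem_range h1 hi) hm
  convert mul_mem (mul_mem (h n (by omega) le_rfl) (h k hmk hkn))
    (dlcm_mul_inv_mem_range hm (hmk.trans hkn)) using 1
  simp only [div_eq_mul_inv, mul_inv, one_mul]
  ring

theorem choose_add_mul_choose {n m k : ℕ} (hmk : m ≤ k) :
    (n + k).choose k * k.choose m = (n + k).choose (k - m) * (n + m).choose m := by
  rw [← Nat.choose_symm hmk, Nat.choose_mul (by omega),
    show n + k - (k - m) = n + m by omega, show k - (k - m) = m by omega]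

theorem two_mul_dlcm_cube_mul_aperyV_mem_range (n : ℕ) :
    2 * (dlcm n : ℚ) ^ 3 * aperyV n ∈ (Int.castRingHom ℚ).range := by
  have hnat (a : ℕ) : (a : ℚ) ∈ (Int.castRingHom ℚ).range := natCast_mem _ a
  rw [aperyV, Finset.mul_sum]
  refine sum_mem fun k hk => ?_
  have hkn : k ≤ n := by simpa [Nat.lt_succ_iff] using hk
  rw [mul_add, mul_add, Finset.mul_sum, Finset.mul_sum, Finset.mul_sum, Finset.mul_sum]
  refine add_mem (sum_mem fun m hm => ?_) (sum_mem fun m hm => ?_)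
  · obtain ⟨hm1, hmn⟩ := Finset.mem_Icc.1 hm
    convert mul_mem (hnat (2 * n.choose k ^ 2 * (n + k).choose k ^ 2))
      (pow_mem (dlcm_mul_inv_mem_range hm1 hmn) 3) using 1
    push_cast
    ring
  · obtain ⟨hm1, hmk⟩ := Finset.mem_Icc.1 hm
    have hm0 : (m : ℚ) ≠ 0 := by exact_mod_cast (by omega : m ≠ 0)
    have hnm : (n.choose m : ℚ) ≠ 0 := by exact_mod_cast (Nat.choose_pos (hmk.trans hkn)).ne'
    have hkm : (k.choose m : ℚ) ≠ 0 := by exact_mod_cast (Nat.choose_pos hmk).ne'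
    have hnmm : ((n + m).choose m : ℚ) ≠ 0 := by
      exact_mod_cast (Nat.choose_pos (Nat.le_add_left m n)).ne'
    have hid : ((n + k).choose k : ℚ) * (k.choose m : ℚ) =
        ((n + k).choose (k - m) : ℚ) * ((n + m).choose m : ℚ) := by
      exact_mod_cast choose_add_mul_choose hmk
    have hsign : (-1 : ℚ) ^ (m - 1) ∈ (Int.castRingHom ℚ).range :=
      pow_mem (neg_mem (one_mem _)) _
    convert mul_mem (mul_mem (hnat (n.choose k ^ 2 * (n + k).choose k * (n + k).choose (k - m)))
      hsign) (dlcm_cube_div_mem_range hm1 hmk hkn) using 1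
    push_cast
    field_simp
    linear_combination ((dlcm n : ℚ) ^ 3 * (n.choose k : ℚ) ^ 2 * ((n + k).choose k : ℚ)) * hid

/-- For every `n ≥ 1`, `2 d_n³ v_n` is an integer; more precisely, for all
`1 ≤ m ≤ k ≤ n`, the rational number `d_n³ / (m³ C(n,m) C(k,m))` is an integer. -/
theorem apery_denominators (n : ℕ) (hn : 1 ≤ n) :
    (∃ t : ℤ, 2 * ((dlcm n : ℚ)) ^ 3 * aperyV n = (t : ℚ)) ∧
    (∀ m k : ℕ, 1 ≤ m → m ≤ k → k ≤ n →
      ∃ t : ℤ, ((dlcm n : ℚ)) ^ 3 /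
        ((m : ℚ) ^ 3 * (n.choose m : ℚ) * (k.choose m : ℚ)) = (t : ℚ)) := by
  refine ⟨?_, fun m k hm hmk hkn => ?_⟩
  · obtain ⟨t, ht⟩ := two_mul_dlcm_cube_mul_aperyV_mem_range n
    exact ⟨t, ht.symm⟩
  · obtain ⟨t, ht⟩ := dlcm_cube_div_mem_range hm hmk hkn
    exact ⟨t, ht.symm⟩
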